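/- arXiv:1509.08590 — 6 statements merged into one kernel-verified Lean document; each statement's English description precedes it below -/
import Mathlib

section
/- Let A be a real symmetric positive-semidefinite m×m matrix and let P be a real m×m orthogonal projection matrix of rank r (r ≤ m). Then Tr(P·A) is at most the sum of the r largest eigenvalues of A (counted with multiplicity, in non-increasing order). -/
open Matrix

/-- The trace of an idempotent matrix over a field is its rank. -/
theorem trace_eq_rank_of_isIdempotentElem {n K : Type*} [Fintype n] [DecidableEq n] [Field K]
    {P : Matrix n n K} (hP : IsIdempotentElem P) : P.trace = (P.rank : K) := by
  have h : IsIdempotentElem (Matrix.toLin' P) := by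
    rw [IsIdempotentElem, Module.End.mul_eq_comp, ← Matrix.toLin'_mul, hP.eq]
  rw [← Matrix.trace_toLin'_eq, (LinearMap.IsIdempotentElem.isProj_range _ h).trace]
  rfl

/-- The diagonal entries of a real symmetric idempotent matrix lie in `[0, 1]`. -/
theorem diag_mem_Icc_of_isSymm_of_isIdempotentElem {n : Type*} [Fintype n]
    {Q : Matrix n n ℝ} (hsymm : Q.IsSymm) (hidem : IsIdempotentElem Q) (i : n) :
    Q i i ∈ Set.Icc (0 : ℝ) 1 := by
  have h : Q i i = ∑ j, Q i j ^ 2 := by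
    conv_lhs => rw [← hidem.eq]
    simp only [Matrix.mul_apply, sq]
    exact Finset.sum_congr rfl fun j _ => by rw [hsymm.apply i j]
  have h0 : 0 ≤ Q i i := h ▸ Finset.sum_nonneg fun j _ => sq_nonneg (Q i j)
  have h1 : Q i i ^ 2 ≤ Q i i := by
    conv_rhs => rw [h]
    exact Finset.single_le_sum (f := fun j => Q i j ^ 2) (fun j _ => sq_nonneg _)
      (Finset.mem_univ i)
  exact ⟨h0, by nlinarith⟩

/-- A weighted sum of a nonnegative antitone family, with weights in `[0, 1]` of total weight `r`,
is at most the sum of its first `r` terms. -/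
theorem sum_mul_le_sum_filter_lt_of_antitone {m r : ℕ} (hr : r ≤ m) {μ w : Fin m → ℝ}
    (hμ : Antitone μ) (hμ0 : ∀ k, 0 ≤ μ k) (hw : ∀ k, w k ∈ Set.Icc (0 : ℝ) 1)
    (hsum : ∑ k, w k = r) :
    ∑ k, w k * μ k ≤ ∑ k ∈ Finset.univ.filter (fun k : Fin m => (k : ℕ) < r), μ k := by
  obtain ⟨c, hc, hc'⟩ : ∃ c, (∀ k : Fin m, (k : ℕ) < r → c ≤ μ k) ∧
      ∀ k : Fin m, ¬ (k : ℕ) < r → μ k ≤ c := by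
    rcases hr.lt_or_eq with h | rfl
    · exact ⟨μ ⟨r, h⟩, fun k hk => hμ (Fin.le_def.2 hk.le),
        fun k hk => hμ (Fin.le_def.2 (not_lt.1 hk))⟩
    · exact ⟨0, fun k _ => hμ0 k, fun k hk => absurd k.2 hk⟩
  have hcard : ∑ k : Fin m, (if (k : ℕ) < r then (1 : ℝ) else 0) = r := by
    rw [Finset.sum_boole, Fin.card_filter_val_lt, min_eq_right hr]
  have hterm : ∀ k : Fin m,
      w k * (μ k - c) ≤ (if (k : ℕ) < r then (1 : ℝ) else 0) * (μ k - c) := by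
    intro k
    split_ifs with hk
    · exact mul_le_mul_of_nonneg_right (hw k).2 (sub_nonneg.2 (hc k hk))
    · rw [zero_mul]
      exact mul_nonpos_of_nonneg_of_nonpos (hw k).1 (sub_nonpos.2 (hc' k hk))
  have h := Finset.sum_le_sum fun k (_ : k ∈ Finset.univ) => hterm k
  simp only [mul_sub, Finset.sum_sub_distrib, ← Finset.sum_mul, hsum, hcard] at h
  rw [Finset.sum_filter]
  simpa using h

/-- Ky Fan-type inequality: for a real symmetric positive-semidefinite matrix `A`
and an orthogonal projection `P` of rank `r`, `Tr (P * A)` is at most the sum of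
the `r` largest eigenvalues of `A` (counted with multiplicity). -/
theorem trace_proj_mul_le_sum_largest_eigenvalues {m : ℕ}
    (A : Matrix (Fin m) (Fin m) ℝ) (hA : A.PosSemidef)
    (P : Matrix (Fin m) (Fin m) ℝ) (hsymm : Pᵀ = P) (hidem : P * P = P)
    (r : ℕ) (hr : r ≤ m) (hrank : P.rank = r)
    (μ : Fin m → ℝ) (hanti : Antitone μ)
    (hperm : ∃ σ : Equiv.Perm (Fin m), μ = hA.1.eigenvalues ∘ σ) :
    (P * A).trace ≤ ∑ k ∈ Finset.univ.filter (fun k : Fin m => (k : ℕ) < r), μ k := by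
  obtain ⟨σ, rfl⟩ := hperm
  let U : Matrix (Fin m) (Fin m) ℝ := ↑hA.1.eigenvectorUnitary
  have hUU : U * Uᵀ = 1 := Unitary.coe_mul_star_self hA.1.eigenvectorUnitary
  have hspec : A = U * diagonal hA.1.eigenvalues * Uᵀ := hA.1.spectral_theorem
  set Q := Uᵀ * P * U with hQ
  have hQsymm : Q.IsSymm := by
    simp [Matrix.IsSymm, hQ, hsymm, Matrix.mul_assoc]
  have hQidem : IsIdempotentElem Q := by
    calc Uᵀ * P * U * (Uᵀ * P * U) = Uᵀ * P * (U * Uᵀ) * P * U := by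
          simp only [Matrix.mul_assoc]
      _ = Uᵀ * (P * P) * U := by rw [hUU, Matrix.mul_one, Matrix.mul_assoc Uᵀ P P]
      _ = Q := by rw [hidem]
  have htrace : ∑ k, Q k k = r := by
    calc Q.trace = (U * Uᵀ * P).trace := by rw [hQ, Matrix.trace_mul_comm, Matrix.mul_assoc]
      _ = r := by rw [hUU, Matrix.one_mul, trace_eq_rank_of_isIdempotentElem hidem, hrank]
  have hPA : (P * A).trace = ∑ k, Q k k * hA.1.eigenvalues k := by
    calc (P * A).trace = (P * U * diagonal hA.1.eigenvalues * Uᵀ).trace := by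
          conv_lhs => rw [hspec]
          simp only [Matrix.mul_assoc]
      _ = (Q * diagonal hA.1.eigenvalues).trace := by
          rw [Matrix.trace_mul_comm, hQ]
          simp only [Matrix.mul_assoc]
      _ = _ := by simp [Matrix.trace, Matrix.mul_diagonal]
  rw [hPA, ← Equiv.sum_comp σ]
  exact sum_mul_le_sum_filter_lt_of_antitone (w := fun k => Q (σ k) (σ k)) hr hanti
    (fun k => hA.eigenvalues_nonneg _)
    (fun k => diag_mem_Icc_of_isSymm_of_isIdempotentElem hQsymm hQidem _)
    ((Equiv.sum_comp σ fun k => Q k k).trans htrace)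
end

section
/- Let M be a real m×n matrix and let r ≤ m. Then there exists a real m×m orthogonal projection matrix P of rank r such that ‖M − P·M‖₂² = λ_r↓ + λ_{r+1}↓ + … + λ_{m−1}↓, where λ₀↓ ≥ λ₁↓ ≥ … ≥ λ_{m−1}↓ are the eigenvalues of M·Mᵀ in non-increasing order; consequently the minimum of ‖M − P·M‖₂² over all rank-r orthogonal projections P equals the sum of the m − r smallest eigenvalues of M·Mᵀ. -/
open Matrix

namespace Matrix

lemma trace_eq_rank_of_mul_self_eq {ι K : Type*} [Fintype ι] [DecidableEq ι] [Field K]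
    {P : Matrix ι ι K} (hP : P * P = P) : P.trace = P.rank := by
  have h : IsIdempotentElem P.toLin' := by
    rw [IsIdempotentElem, Module.End.mul_eq_comp, ← toLin'_mul, hP]
  rw [← trace_toLin'_eq, (LinearMap.IsIdempotentElem.isProj_range _ h).trace]
  rfl

/-- The eigenvalues of a real symmetric matrix, listed in any order, diagonalize it by an
orthogonal matrix. -/
lemma IsHermitian.exists_orthogonal_eq_mul_diagonal_mul {ι : Type*} [Fintype ι] [DecidableEq ι]
    {A : Matrix ι ι ℝ} (hA : A.IsHermitian) (σ : Equiv.Perm ι) :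
    ∃ V : Matrix ι ι ℝ, V * Vᵀ = 1 ∧ Vᵀ * V = 1 ∧
      A = V * diagonal (hA.eigenvalues ∘ σ) * Vᵀ := by
  let U : Matrix ι ι ℝ := hA.eigenvectorUnitary
  have hU : U * Uᵀ = 1 := Unitary.coe_mul_star_self hA.eigenvectorUnitary
  have hV : U.submatrix id σ * (U.submatrix id σ)ᵀ = 1 := by
    rw [transpose_submatrix, submatrix_mul_equiv, hU, submatrix_id_id]
  refine ⟨U.submatrix id σ, hV, mul_eq_one_comm.mp hV, ?_⟩
  have hs : A = U * diagonal hA.eigenvalues * Uᵀ := hA.spectral_theorem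
  rw [← submatrix_diagonal_equiv, transpose_submatrix, submatrix_mul_equiv, submatrix_mul_equiv,
    submatrix_id_id, ← hs]

/-- The squared Frobenius distance from `M` to `P * M`, in an orthonormal eigenbasis of
`M * Mᵀ`. -/
lemma trace_sub_mul_mul_transpose_eq_sum {ι κ R : Type*} [Fintype ι] [DecidableEq ι] [Fintype κ]
    [CommRing R] {M : Matrix ι κ R} {P V : Matrix ι ι R} {μ : ι → R} (hPt : Pᵀ = P)
    (hP : P * P = P) (hV : Vᵀ * V = 1) (hM : M * Mᵀ = V * diagonal μ * Vᵀ) :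
    ((M - P * M) * (M - P * M)ᵀ).trace = ∑ k, μ k * (1 - (Vᵀ * P * V) k k) := by
  have h₁ : (M - P * M) * (M - P * M)ᵀ = (1 - P) * (M * Mᵀ) * (1 - P) := by
    simp only [transpose_sub, transpose_mul, hPt, Matrix.sub_mul, Matrix.mul_sub, Matrix.one_mul,
      Matrix.mul_one, Matrix.mul_assoc]
  have h₂ : (1 - P) * (1 - P) = 1 - P := by
    rw [mul_sub, sub_mul, sub_mul, hP]
    simp
  have h₃ : Vᵀ * (1 - P) * V = 1 - Vᵀ * P * V := by
    rw [mul_sub, sub_mul, mul_one, hV]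
  have h₄ : (1 - P) * (V * diagonal μ * Vᵀ) = ((1 - P) * V * diagonal μ) * Vᵀ := by
    simp only [Matrix.mul_assoc]
  rw [h₁, trace_mul_comm, ← Matrix.mul_assoc, h₂, hM, h₄, trace_mul_comm, ← Matrix.mul_assoc,
    ← Matrix.mul_assoc, h₃]
  simp [trace, mul_comm]

/-- The diagonal entries of a real orthogonal projection lie in the unit interval. -/
lemma diag_mem_Icc_of_transpose_eq_of_mul_self_eq {ι : Type*} [Fintype ι]
    {Q : Matrix ι ι ℝ} (hQt : Qᵀ = Q) (hQ : Q * Q = Q) (k : ι) : Q k k ∈ Set.Icc 0 1 := by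
  have h : Q k k = ∑ j, Q k j ^ 2 := by
    conv_lhs => rw [← hQ, mul_apply]
    refine Finset.sum_congr rfl fun j _ => ?_
    rw [sq]
    congr 1
    exact congrFun₂ hQt k j
  have h' : Q k k ^ 2 ≤ Q k k := by
    conv_rhs => rw [h]
    exact Finset.single_le_sum (f := fun j => Q k j ^ 2) (fun j _ => sq_nonneg _)
      (Finset.mem_univ k)
  constructor <;> nlinarith

end Matrix

/-- A weighted sum of a non-increasing sequence, with weights in the unit interval of total
`m - r`, is at least the sum of the `m - r` smallest terms. -/
lemma Antitone.sum_filter_le_sum_mul_one_sub {m r : ℕ} {μ q : Fin m → ℝ} (hμ : Antitone μ)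
    (hq : ∀ k, q k ∈ Set.Icc 0 1) (hsum : ∑ k, q k = r) (hr : r ≤ m) :
    ∑ k ∈ Finset.univ.filter (fun k : Fin m => r ≤ (k : ℕ)), μ k ≤ ∑ k, μ k * (1 - q k) := by
  obtain ⟨c, hc, hc'⟩ : ∃ c, (∀ k : Fin m, (k : ℕ) < r → c ≤ μ k) ∧
      ∀ k : Fin m, r ≤ (k : ℕ) → μ k ≤ c := by
    rcases m.eq_zero_or_pos with rfl | hm
    · exact ⟨0, fun k => k.elim0, fun k => k.elim0⟩
    · refine ⟨μ ⟨min r (m - 1), by omega⟩, fun k hk => hμ ?_, fun k hk => hμ ?_⟩ <;>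
        simp only [Fin.le_def] <;> omega
  have hone : ∑ k : Fin m, (if (k : ℕ) < r then (1 : ℝ) else 0) = r := by
    rw [Finset.sum_boole, Fin.card_filter_val_lt, min_eq_right hr]
  have key : 0 ≤ ∑ k, (μ k - c) * ((if (k : ℕ) < r then (1 : ℝ) else 0) - q k) := by
    refine Finset.sum_nonneg fun k _ => ?_
    obtain ⟨h0, h1⟩ := hq k
    split_ifs with hk
    · exact mul_nonneg (sub_nonneg.mpr (hc k hk)) (sub_nonneg.mpr h1)
    · exact mul_nonneg_of_nonpos_of_nonpos (sub_nonpos.mpr (hc' k (not_lt.mp hk))) (by linarith)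
  have hsplit : ∑ k, (μ k - c) * ((if (k : ℕ) < r then (1 : ℝ) else 0) - q k) =
      ∑ k, μ k * (1 - q k) - ∑ k ∈ Finset.univ.filter (fun k : Fin m => r ≤ (k : ℕ)), μ k -
        c * (∑ k : Fin m, (if (k : ℕ) < r then (1 : ℝ) else 0) - ∑ k, q k) := by
    rw [Finset.sum_filter, ← Finset.sum_sub_distrib, ← Finset.sum_sub_distrib, Finset.mul_sum,
      ← Finset.sum_sub_distrib]
    refine Finset.sum_congr rfl fun k _ => ?_
    by_cases hk : (k : ℕ) < r
    · simp only [hk, if_true, not_le.mpr hk, if_false]; ring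
    · simp only [hk, if_false, not_lt.mp hk, if_true]; ring
  rw [hsplit, hone, hsum] at key
  linarith

/-- There exists a rank-`r` orthogonal projection `P` attaining
`‖M - P * M‖₂² = ` the sum of the `m - r` smallest eigenvalues of `M * Mᵀ`;
consequently this sum is the minimum of `‖M - P * M‖₂²` over all rank-`r`
orthogonal projections. -/
theorem isLeast_frobenius_sq_sub_proj {m n : ℕ}
    (M : Matrix (Fin m) (Fin n) ℝ) (hH : (M * Mᵀ).IsHermitian)
    (r : ℕ) (hr : r ≤ m)
    (μ : Fin m → ℝ) (hanti : Antitone μ)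
    (hperm : ∃ σ : Equiv.Perm (Fin m), μ = hH.eigenvalues ∘ σ) :
    IsLeast {x : ℝ | ∃ P : Matrix (Fin m) (Fin m) ℝ, Pᵀ = P ∧ P * P = P ∧ P.rank = r ∧
        x = ((M - P * M) * (M - P * M)ᵀ).trace}
      (∑ k ∈ Finset.univ.filter (fun k : Fin m => r ≤ (k : ℕ)), μ k) := by
  obtain ⟨σ, rfl⟩ := hperm
  obtain ⟨V, hV, hV', hM⟩ := hH.exists_orthogonal_eq_mul_diagonal_mul σ
  constructor
  · let D : Matrix (Fin m) (Fin m) ℝ := diagonal fun k => if (k : ℕ) < r then 1 else 0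
    have hD : D * D = D := by simp [D]
    have hVD : Vᵀ * (V * D * Vᵀ) * V = D := by
      rw [Matrix.mul_assoc V, ← Matrix.mul_assoc, hV', Matrix.one_mul, Matrix.mul_assoc, hV',
        Matrix.mul_one]
    have hPt : (V * D * Vᵀ)ᵀ = V * D * Vᵀ := by
      simp [D, transpose_mul, Matrix.mul_assoc]
    have hP : V * D * Vᵀ * (V * D * Vᵀ) = V * D * Vᵀ := by
      calc V * D * Vᵀ * (V * D * Vᵀ) = V * D * (Vᵀ * V) * D * Vᵀ := by
            simp only [Matrix.mul_assoc]
        _ = V * D * Vᵀ := by rw [hV', Matrix.mul_one, Matrix.mul_assoc V, hD]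
    refine ⟨V * D * Vᵀ, hPt, hP, ?_, ?_⟩
    · have htr : (V * D * Vᵀ).trace = r := by
        rw [trace_mul_comm, ← Matrix.mul_assoc, hV', Matrix.one_mul, trace_diagonal,
          Finset.sum_boole, Fin.card_filter_val_lt, min_eq_right hr]
      exact_mod_cast (trace_eq_rank_of_mul_self_eq hP).symm.trans htr
    · rw [trace_sub_mul_mul_transpose_eq_sum hPt hP hV' hM, hVD, Finset.sum_filter]
      refine Finset.sum_congr rfl fun k _ => ?_
      by_cases hk : (k : ℕ) < r <;> simp [D, hk, not_le.mpr, not_lt.mp]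
  · rintro _ ⟨P, hPt, hP, hrank, rfl⟩
    rw [trace_sub_mul_mul_transpose_eq_sum hPt hP hV' hM]
    refine hanti.sum_filter_le_sum_mul_one_sub
      (fun k => diag_mem_Icc_of_transpose_eq_of_mul_self_eq ?_ ?_ k) ?_ hr
    · simp only [transpose_mul, transpose_transpose, hPt, Matrix.mul_assoc]
    · calc Vᵀ * P * V * (Vᵀ * P * V) = Vᵀ * P * (V * Vᵀ) * P * V := by
            simp only [Matrix.mul_assoc]
        _ = Vᵀ * P * V := by rw [hV, Matrix.mul_one, Matrix.mul_assoc Vᵀ, hP]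
    · change (Vᵀ * P * V).trace = r
      rw [trace_mul_comm, ← Matrix.mul_assoc, hV, Matrix.one_mul,
        trace_eq_rank_of_mul_self_eq hP, hrank]
end

section
/- Let λ, t₁, r₁, r₂, r₃ be real numbers, and let M be the real 3×4 matrix M = (1/2)·[[r₁(1−λ), λt₁, 0, 0], [r₂(1−λ), 0, 0, 0], [r₃(1−λ), 0, 0, 0]]. Set h = λ²t₁² + (1−λ)²(r₁² + r₂² + r₃²) and k = 2λ(1−λ)t₁·√(r₂² + r₃²). Then the minimum of ‖M − P·M‖₂² over all real 3×3 orthogonal projection matrices P of rank 1 equals (1/8)·(h − √(h² − k²)). -/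
open Matrix

/-- The `B`-correlation matrix `𝒯^B_{P̃_A}` of the post-projection state `ρ_{P̃_A}`. -/
noncomputable def corrMatB (l t₁ r₁ r₂ r₃ : ℝ) : Matrix (Fin 3) (Fin 4) ℝ :=
  (1 / 2 : ℝ) • !![r₁ * (1 - l), l * t₁, 0, 0;
                   r₂ * (1 - l), 0, 0, 0;
                   r₃ * (1 - l), 0, 0, 0]

lemma dotProduct_self_nonneg_real {ι : Type*} [Fintype ι] (v : ι → ℝ) : 0 ≤ v ⬝ᵥ v :=
  Finset.sum_nonneg fun i _ => mul_self_nonneg (v i)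

/-- A rank-one orthogonal projection is `v vᵀ` for some unit vector `v`. -/
lemma exists_eq_vecMulVec_of_rank_eq_one {ι : Type*} [Fintype ι] [DecidableEq ι]
    {P : Matrix ι ι ℝ} (hT : Pᵀ = P) (hP : P * P = P) (hr : P.rank = 1) :
    ∃ v : ι → ℝ, v ⬝ᵥ v = 1 ∧ P = vecMulVec v v := by
  obtain ⟨a, -, ha⟩ := finrank_eq_one_iff'.mp (show Module.finrank ℝ P.mulVecLin.range = 1 from hr)
  have hcol : ∀ j, ∃ c : ℝ, c • (a : ι → ℝ) = P.col j := fun j => by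
    obtain ⟨c, hc⟩ := ha ⟨P *ᵥ Pi.single j 1, LinearMap.mem_range_self _ _⟩
    refine ⟨c, ?_⟩
    rw [← mulVec_single_one]
    exact congrArg Subtype.val hc
  choose c hc using hcol
  have hPac : P = vecMulVec (a : ι → ℝ) c := by
    ext i j
    rw [vecMulVec_apply, mul_comm]
    exact (congrFun (hc j) i).symm
  generalize (a : ι → ℝ) = b at hPac
  have hc0 : 0 ≤ c ⬝ᵥ c := dotProduct_self_nonneg_real c
  have hPa : P = (c ⬝ᵥ c) • vecMulVec b b := by
    calc P = P * Pᵀ := by rw [hT, hP]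
      _ = _ := by
        rw [hPac, transpose_vecMulVec, vecMulVec_mul_vecMulVec, vecMulVec_smul]
  have hPv : P = vecMulVec (√(c ⬝ᵥ c) • b) (√(c ⬝ᵥ c) • b) := by
    rw [smul_vecMulVec, vecMulVec_smul, smul_smul, Real.mul_self_sqrt hc0, ← hPa]
  generalize √(c ⬝ᵥ c) • b = v at hPv
  refine ⟨v, ?_, hPv⟩
  have hP0 : P ≠ 0 := by
    rintro rfl
    simp at hr
  have h : (v ⬝ᵥ v) • P = (1 : ℝ) • P := by
    rw [one_smul]
    conv_rhs => rw [← hP, hPv, vecMulVec_mul_vecMulVec, vecMulVec_smul, ← hPv]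
  exact smul_left_injective ℝ hP0 h

lemma rank_vecMulVec_self_of_dotProduct_eq_one {ι : Type*} [Fintype ι]
    {v : ι → ℝ} (hv : v ⬝ᵥ v = 1) : (vecMulVec v v).rank = 1 := by
  refine le_antisymm (rank_vecMulVec_le v v) ?_
  rw [Nat.one_le_iff_ne_zero]
  intro h
  have hbot : (vecMulVec v v).mulVecLin.range = ⊥ := Submodule.finrank_eq_zero.mp h
  have hv0 : vecMulVec v v *ᵥ v = 0 := by
    have := LinearMap.mem_range_self (vecMulVec v v).mulVecLin v
    rw [hbot] at this
    simpa using this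
  have hvv : v = 0 := by simpa [vecMulVec_mulVec, hv] using hv0
  simp [hvv] at hv

/-- The sum of the squared projections of `u` and `w` on a line is at most the largest eigenvalue
of their Gram matrix. -/
lemma sq_dotProduct_add_sq_dotProduct_le {ι : Type*} [Fintype ι] (u w : ι → ℝ)
    {v : ι → ℝ} (hv : v ⬝ᵥ v = 1) :
    (v ⬝ᵥ u) ^ 2 + (v ⬝ᵥ w) ^ 2 ≤
      (u ⬝ᵥ u + w ⬝ᵥ w + √((u ⬝ᵥ u - w ⬝ᵥ w) ^ 2 + 4 * (u ⬝ᵥ w) ^ 2)) / 2 := by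
  set x := v ⬝ᵥ u with hx
  set y := v ⬝ᵥ w with hy
  have hcs : (x ^ 2 + y ^ 2) ^ 2 ≤
      x ^ 2 * (u ⬝ᵥ u) + 2 * x * y * (u ⬝ᵥ w) + y ^ 2 * (w ⬝ᵥ w) := by
    have h0 := dotProduct_self_nonneg_real (x • u + y • w - (x ^ 2 + y ^ 2) • v)
    simp only [sub_dotProduct, dotProduct_sub, add_dotProduct, dotProduct_add, smul_dotProduct,
      dotProduct_smul, smul_eq_mul, hv, dotProduct_comm u v, dotProduct_comm w v,
      dotProduct_comm w u, ← hx, ← hy] at h0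
    linarith
  have hA := dotProduct_self_nonneg_real u
  have hB := dotProduct_self_nonneg_real w
  generalize u ⬝ᵥ u = A at *
  generalize w ⬝ᵥ w = B at *
  generalize u ⬝ᵥ w = C at *
  have hs0 := Real.sqrt_nonneg ((A - B) ^ 2 + 4 * C ^ 2)
  have hs := Real.sq_sqrt (show 0 ≤ (A - B) ^ 2 + 4 * C ^ 2 by positivity)
  generalize √((A - B) ^ 2 + 4 * C ^ 2) = s at *
  have hq : (x ^ 2 - y ^ 2) * (A - B) + 4 * x * y * C ≤ (x ^ 2 + y ^ 2) * s := by
    refine abs_le_of_sq_le_sq' ?_ (by positivity) |>.2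
    rw [mul_pow, hs]
    linarith [sq_nonneg ((x ^ 2 - y ^ 2) * (2 * C) - 2 * x * y * (A - B))]
  rcases (show 0 ≤ x ^ 2 + y ^ 2 by positivity).eq_or_lt with h0 | h0
  · linarith
  · refine le_of_mul_le_mul_left ?_ h0
    linarith

/-- The largest eigenvalue of the Gram matrix of `u` and `w` is the sum of the squared projections
of `u` and `w` on some line. -/
lemma exists_sq_dotProduct_add_sq_dotProduct_eq {ι : Type*} [Fintype ι] [Nonempty ι]
    (u w : ι → ℝ) :
    ∃ v : ι → ℝ, v ⬝ᵥ v = 1 ∧ (v ⬝ᵥ u) ^ 2 + (v ⬝ᵥ w) ^ 2 =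
      (u ⬝ᵥ u + w ⬝ᵥ w + √((u ⬝ᵥ u - w ⬝ᵥ w) ^ 2 + 4 * (u ⬝ᵥ w) ^ 2)) / 2 := by
  classical
  have hA := dotProduct_self_nonneg_real u
  have hB := dotProduct_self_nonneg_real w
  set s := √((u ⬝ᵥ u - w ⬝ᵥ w) ^ 2 + 4 * (u ⬝ᵥ w) ^ 2) with hs
  have hs0 : 0 ≤ s := Real.sqrt_nonneg _
  set m := (u ⬝ᵥ u + w ⬝ᵥ w + s) / 2 with hm
  rcases (show 0 ≤ m by positivity).eq_or_lt with h0 | h0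
  · have hu : u = 0 := dotProduct_self_eq_zero.mp (by linarith)
    have hw : w = 0 := dotProduct_self_eq_zero.mp (by linarith)
    exact ⟨Pi.single (Classical.arbitrary ι) 1, by simp, by simp [← h0, hu, hw]⟩
  obtain ⟨x, y, hxy, hD, hE⟩ : ∃ x y : ℝ, x ^ 2 + y ^ 2 = 1 ∧
      u ⬝ᵥ u - w ⬝ᵥ w = s * (x ^ 2 - y ^ 2) ∧ 2 * (u ⬝ᵥ w) = s * (2 * x * y) := by
    let z : ℂ := ⟨u ⬝ᵥ u - w ⬝ᵥ w, 2 * (u ⬝ᵥ w)⟩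
    have hz : ‖z‖ = s := by
      rw [hs, Complex.norm_def, Complex.normSq_mk]
      ring_nf
    refine ⟨Real.cos (z.arg / 2), Real.sin (z.arg / 2), Real.cos_sq_add_sin_sq _, ?_, ?_⟩
    · rw [← Real.cos_two_mul', mul_div_cancel₀ _ two_ne_zero, ← hz, Complex.norm_mul_cos_arg]
    · rw [mul_right_comm, ← Real.sin_two_mul, mul_div_cancel₀ _ two_ne_zero, ← hz,
        Complex.norm_mul_sin_arg]
  have hx : x * (u ⬝ᵥ u) + y * (u ⬝ᵥ w) = m * x := by
    linear_combination x / 2 * hD + y / 2 * hE + s * x / 2 * hxy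
  have hy : x * (u ⬝ᵥ w) + y * (w ⬝ᵥ w) = m * y := by
    linear_combination x / 2 * hE - y / 2 * hD + s * y / 2 * hxy
  have hr : √m ^ 2 = m := Real.sq_sqrt h0.le
  have hr0 : √m ≠ 0 := (Real.sqrt_pos.mpr h0).ne'
  have hu : ((√m)⁻¹ • (x • u + y • w)) ⬝ᵥ u = √m * x := by
    simp only [add_dotProduct, smul_dotProduct, smul_eq_mul, dotProduct_comm w u, hx]
    field_simp
    rw [hr]
  have hw : ((√m)⁻¹ • (x • u + y • w)) ⬝ᵥ w = √m * y := by
    simp only [add_dotProduct, smul_dotProduct, smul_eq_mul, hy]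
    field_simp
    rw [hr]
  refine ⟨(√m)⁻¹ • (x • u + y • w), ?_, ?_⟩
  · rw [dotProduct_smul, dotProduct_add, dotProduct_smul, dotProduct_smul, hu, hw]
    simp only [smul_eq_mul]
    field_simp
    exact hxy
  · rw [hu, hw, mul_pow, mul_pow, ← mul_add, hxy, hr, mul_one]

lemma trace_sub_vecMulVec_mul {m n : Type*} [Fintype m] [Fintype n]
    (M : Matrix m n ℝ) {v : m → ℝ} (hv : v ⬝ᵥ v = 1) :
    ((M - vecMulVec v v * M) * (M - vecMulVec v v * M)ᵀ).trace =
      (M * Mᵀ).trace - (v ᵥ* M) ⬝ᵥ (v ᵥ* M) := by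
  have h : (v ᵥ* M) ⬝ᵥ (v ᵥ* M) = v ⬝ᵥ (M *ᵥ (v ᵥ* M)) := dotProduct_mulVec _ _ _ |>.symm
  rw [vecMulVec_mul, transpose_sub, transpose_vecMulVec, Matrix.sub_mul, Matrix.mul_sub, Matrix.mul_sub, trace_sub,
    trace_sub, trace_sub, mul_vecMulVec, vecMulVec_mul, vecMulVec_mul_vecMulVec, vecMulVec_smul,
    trace_smul, trace_vecMulVec, trace_vecMulVec, trace_vecMulVec, hv, vecMul_transpose,
    dotProduct_comm _ v, ← h]
  simp

/-- With `h = λ²t₁² + (1-λ)²(r₁²+r₂²+r₃²)` and `k = 2λ(1-λ)t₁√(r₂²+r₃²)`, the minimum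
of `‖M - P * M‖₂²` over rank-1 orthogonal projections `P`, with `M = corrMatB l t₁ r₁ r₂ r₃`,
equals `(1/8)(h - √(h² - k²))`. -/
theorem qb_post_projection (l t₁ r₁ r₂ r₃ : ℝ) :
    IsLeast {x : ℝ | ∃ P : Matrix (Fin 3) (Fin 3) ℝ, Pᵀ = P ∧ P * P = P ∧ P.rank = 1 ∧
        x = ((corrMatB l t₁ r₁ r₂ r₃ - P * corrMatB l t₁ r₁ r₂ r₃) *
              (corrMatB l t₁ r₁ r₂ r₃ - P * corrMatB l t₁ r₁ r₂ r₃)ᵀ).trace}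
      (1 / 8 * ((l ^ 2 * t₁ ^ 2 + (1 - l) ^ 2 * (r₁ ^ 2 + r₂ ^ 2 + r₃ ^ 2)) -
        Real.sqrt ((l ^ 2 * t₁ ^ 2 + (1 - l) ^ 2 * (r₁ ^ 2 + r₂ ^ 2 + r₃ ^ 2)) ^ 2 -
          (2 * l * (1 - l) * t₁ * Real.sqrt (r₂ ^ 2 + r₃ ^ 2)) ^ 2))) := by
  set u : Fin 3 → ℝ := ![r₁ * (1 - l), r₂ * (1 - l), r₃ * (1 - l)] with hu
  set w : Fin 3 → ℝ := ![l * t₁, 0, 0] with hw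
  have hval : 1 / 8 * ((l ^ 2 * t₁ ^ 2 + (1 - l) ^ 2 * (r₁ ^ 2 + r₂ ^ 2 + r₃ ^ 2)) -
        √((l ^ 2 * t₁ ^ 2 + (1 - l) ^ 2 * (r₁ ^ 2 + r₂ ^ 2 + r₃ ^ 2)) ^ 2 -
          (2 * l * (1 - l) * t₁ * √(r₂ ^ 2 + r₃ ^ 2)) ^ 2)) =
      1 / 4 * (u ⬝ᵥ u + w ⬝ᵥ w -
        (u ⬝ᵥ u + w ⬝ᵥ w + √((u ⬝ᵥ u - w ⬝ᵥ w) ^ 2 + 4 * (u ⬝ᵥ w) ^ 2)) / 2) := by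
    have hdisc : (l ^ 2 * t₁ ^ 2 + (1 - l) ^ 2 * (r₁ ^ 2 + r₂ ^ 2 + r₃ ^ 2)) ^ 2 -
          (2 * l * (1 - l) * t₁ * √(r₂ ^ 2 + r₃ ^ 2)) ^ 2 =
        (u ⬝ᵥ u - w ⬝ᵥ w) ^ 2 + 4 * (u ⬝ᵥ w) ^ 2 := by
      rw [mul_pow _ √_, Real.sq_sqrt (by positivity)]
      simp [hu, hw, dotProduct, Fin.sum_univ_three]
      ring
    rw [hdisc]
    simp [hu, hw, dotProduct, Fin.sum_univ_three]
    ring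
  have hobj : ∀ v : Fin 3 → ℝ, v ⬝ᵥ v = 1 →
      ((corrMatB l t₁ r₁ r₂ r₃ - vecMulVec v v * corrMatB l t₁ r₁ r₂ r₃) *
        (corrMatB l t₁ r₁ r₂ r₃ - vecMulVec v v * corrMatB l t₁ r₁ r₂ r₃)ᵀ).trace =
      1 / 4 * (u ⬝ᵥ u + w ⬝ᵥ w - ((v ⬝ᵥ u) ^ 2 + (v ⬝ᵥ w) ^ 2)) := by
    intro v hv
    rw [trace_sub_vecMulVec_mul _ hv]
    simp [hu, hw, corrMatB, dotProduct, vecMul, trace, Fin.sum_univ_succ]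
    ring
  rw [hval]
  constructor
  · obtain ⟨v, hv, hmax⟩ := exists_sq_dotProduct_add_sq_dotProduct_eq u w
    refine ⟨vecMulVec v v, transpose_vecMulVec v v, ?_,
      rank_vecMulVec_self_of_dotProduct_eq_one hv, ?_⟩
    · rw [vecMulVec_mul_vecMulVec, hv, one_smul]
    · rw [hobj v hv, hmax]
  · rintro _ ⟨P, hT, hP, hr, rfl⟩
    obtain ⟨v, hv, rfl⟩ := exists_eq_vecMulVec_of_rank_eq_one hT hP hr
    rw [hobj v hv]
    linarith [sq_dotProduct_add_sq_dotProduct_le u w hv]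
end

section
/- Let λ, r₂, t₁ be real numbers and let M be the real 3×4 matrix M = (1/2)·[[0, λt₁, 0, 0], [r₂(1−λ), 0, 0, 0], [0, 0, 0, 0]]. Then the minimum of ‖M − P·M‖₂² over all real 3×3 orthogonal projection matrices P of rank 1 equals (1/4)·min{λ²t₁², r₂²(1−λ)²}. -/
open Matrix

/-- The `B`-correlation matrix `𝒯^B_{P̃_A}` of the post-projection state obtained from
`ρ = λ ρ_BD + (1-λ) ρ_p` with `r₁ = r₃ = 0` after the optimal projection `P̃_A = diag(1,0,0)`. -/
noncomputable def corrMatBPost (l r₂ t₁ : ℝ) : Matrix (Fin 3) (Fin 4) ℝ :=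
  (1 / 2 : ℝ) • !![0, l * t₁, 0, 0;
                   r₂ * (1 - l), 0, 0, 0;
                   0, 0, 0, 0]

/-- The trace of an idempotent matrix over a field is its rank. -/
theorem Matrix.trace_eq_rank_of_mul_self {n K : Type*} [Fintype n] [DecidableEq n] [Field K]
    {P : Matrix n n K} (hP : P * P = P) : P.trace = P.rank := by
  have h : IsIdempotentElem (Matrix.toLin' P) := by
    rw [IsIdempotentElem, Module.End.mul_eq_comp, ← Matrix.toLin'_mul, hP]
  rw [← Matrix.trace_toLin'_eq, (LinearMap.IsIdempotentElem.isProj_range _ h).trace]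
  rfl

/-- The diagonal entries of a real orthogonal projection are the squared norms of its columns. -/
theorem Matrix.diag_eq_sum_sq {n : Type*} [Fintype n] {P : Matrix n n ℝ}
    (hT : Pᵀ = P) (hP : P * P = P) (i : n) : P i i = ∑ j, P j i ^ 2 := by
  conv_lhs => rw [← hP, Matrix.mul_apply]
  refine Finset.sum_congr rfl fun j _ => ?_
  rw [sq, ← Matrix.transpose_apply P, hT]

theorem trace_corrMatBPost_sub_proj (l r₂ t₁ : ℝ) {P : Matrix (Fin 3) (Fin 3) ℝ}
    (hT : Pᵀ = P) (hP : P * P = P) :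
    ((corrMatBPost l r₂ t₁ - P * corrMatBPost l r₂ t₁) *
      (corrMatBPost l r₂ t₁ - P * corrMatBPost l r₂ t₁)ᵀ).trace =
    1 / 4 * (l ^ 2 * t₁ ^ 2 * (1 - P 0 0) + r₂ ^ 2 * (1 - l) ^ 2 * (1 - P 1 1)) := by
  have h0 := Matrix.diag_eq_sum_sq hT hP 0
  have h1 := Matrix.diag_eq_sum_sq hT hP 1
  simp only [Fin.sum_univ_three] at h0 h1
  simp [corrMatBPost, Matrix.trace, Matrix.mul_apply, Fin.sum_univ_succ]
  linear_combination (-(l ^ 2 * t₁ ^ 2) / 4) * h0 - (r₂ ^ 2 * (1 - l) ^ 2 / 4) * h1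

/-- The minimum of `‖M - P * M‖₂²` over rank-1 orthogonal projections `P`, with
`M = corrMatBPost l r₂ t₁`, equals `(1/4)·min{λ²t₁², r₂²(1-λ)²}`. -/
theorem qb_post_projection_special (l r₂ t₁ : ℝ) :
    IsLeast {x : ℝ | ∃ P : Matrix (Fin 3) (Fin 3) ℝ, Pᵀ = P ∧ P * P = P ∧ P.rank = 1 ∧
        x = ((corrMatBPost l r₂ t₁ - P * corrMatBPost l r₂ t₁) *
              (corrMatBPost l r₂ t₁ - P * corrMatBPost l r₂ t₁)ᵀ).trace}
      (1 / 4 * min (l ^ 2 * t₁ ^ 2) (r₂ ^ 2 * (1 - l) ^ 2)) := by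
  constructor
  · have key (i : Fin 3) : ∃ P : Matrix (Fin 3) (Fin 3) ℝ, Pᵀ = P ∧ P * P = P ∧ P.rank = 1 ∧
        P = diagonal (Pi.single i 1) := by
      have hP : (diagonal (Pi.single i 1) * diagonal (Pi.single i 1) : Matrix (Fin 3) (Fin 3) ℝ) =
          diagonal (Pi.single i 1) := by
        rw [diagonal_mul_diagonal]
        congr 1
        ext j
        by_cases h : j = i <;> simp [h]
      refine ⟨_, diagonal_transpose _, hP, ?_, rfl⟩
      have h := Matrix.trace_eq_rank_of_mul_self hP
      rw [trace_diagonal, Finset.sum_pi_single', if_pos (Finset.mem_univ i)] at h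
      exact_mod_cast h.symm
    rcases le_total (l ^ 2 * t₁ ^ 2) (r₂ ^ 2 * (1 - l) ^ 2) with h | h
    · obtain ⟨P, hT, hP, hr, hd⟩ := key 1
      refine ⟨P, hT, hP, hr, ?_⟩
      rw [trace_corrMatBPost_sub_proj l r₂ t₁ hT hP, min_eq_left h]
      simp [hd]
    · obtain ⟨P, hT, hP, hr, hd⟩ := key 0
      refine ⟨P, hT, hP, hr, ?_⟩
      rw [trace_corrMatBPost_sub_proj l r₂ t₁ hT hP, min_eq_right h]
      simp [hd]
  · rintro x ⟨P, hT, hP, hr, rfl⟩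
    rw [trace_corrMatBPost_sub_proj l r₂ t₁ hT hP]
    have htr := Matrix.trace_eq_rank_of_mul_self hP
    rw [hr, Matrix.trace_fin_three, Nat.cast_one] at htr
    have hnn (i : Fin 3) : 0 ≤ P i i := by
      rw [Matrix.diag_eq_sum_sq hT hP i]
      positivity
    have h0 := hnn 0
    have h1 := hnn 1
    have h2 := hnn 2
    have hm : 0 ≤ min (l ^ 2 * t₁ ^ 2) (r₂ ^ 2 * (1 - l) ^ 2) :=
      le_min (by positivity) (by positivity)
    have ha := mul_le_mul_of_nonneg_right (min_le_left (l ^ 2 * t₁ ^ 2) (r₂ ^ 2 * (1 - l) ^ 2))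
      (show 0 ≤ 1 - P 0 0 by linarith)
    have hb := mul_le_mul_of_nonneg_right (min_le_right (l ^ 2 * t₁ ^ 2) (r₂ ^ 2 * (1 - l) ^ 2))
      (show 0 ≤ 1 - P 1 1 by linarith)
    have hc := mul_nonneg hm (show 0 ≤ 1 - P 0 0 - P 1 1 by linarith)
    linarith
end

section
/- Let 0 ≤ λ ≤ 1 and let ρ be the 8×8 complex matrix ρ = ((1−λ)/8)·I₈ + λ·|GHZ⟩⟨GHZ|, where, indexing ℂ⁸ = ℂ²⊗ℂ²⊗ℂ² via Kronecker products, |GHZ⟩⟨GHZ| is the rank-one projector onto (|000⟩ + |111⟩)/√2. Let σ₀ = I₂, and σ₁, σ₂, σ₃ the Pauli matrices, and define the real 3×16 matrix M, with rows indexed by i ∈ {1,2,3} and columns by pairs (j,k) ∈ {0,1,2,3}², by M_{i,(j,k)} = (1/(2√2))·Re Tr[(σᵢ ⊗ σⱼ ⊗ σₖ)·ρ] (Kronecker products). Then M·Mᵀ = (λ²/4)·I₃, and consequently the minimum of ‖M − P·M‖₂² over all real 3×3 orthogonal projection matrices P of rank 1 equals λ²/2. -/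
open Matrix Complex
open scoped Kronecker

/-- The Pauli matrices, with `pauli 0 = I₂`. -/
noncomputable def pauli : Fin 4 → Matrix (Fin 2) (Fin 2) ℂ
  | 0 => 1
  | 1 => !![0, 1; 1, 0]
  | 2 => !![0, -I; I, 0]
  | 3 => !![1, 0; 0, -1]

/-- The GHZ vector `(|000⟩ + |111⟩)/√2` in `ℂ² ⊗ ℂ² ⊗ ℂ²`. -/
noncomputable def ghz : Fin 2 × Fin 2 × Fin 2 → ℂ := fun x =>
  if (x.1 = 0 ∧ x.2.1 = 0 ∧ x.2.2 = 0) ∨ (x.1 = 1 ∧ x.2.1 = 1 ∧ x.2.2 = 1)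
    then ((1 / Real.sqrt 2 : ℝ) : ℂ) else 0

/-- The Werner-GHZ state `ρ = ((1-λ)/8)·I₈ + λ·|GHZ⟩⟨GHZ|`. -/
noncomputable def wernerGHZ (l : ℝ) :
    Matrix (Fin 2 × Fin 2 × Fin 2) (Fin 2 × Fin 2 × Fin 2) ℂ :=
  (((1 - l) / 8 : ℝ) : ℂ) • 1 + (l : ℂ) • Matrix.vecMulVec ghz (star ghz)

/-- The `A₁`-correlation matrix of the Werner-GHZ state:
`M i (j,k) = (1/(2√2))·Re Tr[(σ_{i+1} ⊗ σ_j ⊗ σ_k) ρ]` for `i ∈ {1,2,3}` (rows indexed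
by `Fin 3` via `i.succ`) and `(j,k) ∈ {0,1,2,3}²`. -/
noncomputable def corrMatWernerGHZ (l : ℝ) : Matrix (Fin 3) (Fin 4 × Fin 4) ℝ :=
  Matrix.of fun i jk =>
    (1 / (2 * Real.sqrt 2)) *
      (((pauli i.succ ⊗ₖ (pauli jk.1 ⊗ₖ pauli jk.2)) * wernerGHZ l).trace).re

lemma ghz_apply (a b c : Fin 2) :
    ghz (a, b, c) = if a = b ∧ b = c then ((1 / Real.sqrt 2 : ℝ) : ℂ) else 0 := by
  fin_cases a <;> fin_cases b <;> fin_cases c <;> simp [ghz]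

lemma trace_kronecker_mul_vecMulVec_ghz (A B C : Matrix (Fin 2) (Fin 2) ℂ) :
    ((A ⊗ₖ (B ⊗ₖ C)) * Matrix.vecMulVec ghz (star ghz)).trace =
      (1 / 2) * ∑ a, ∑ b, A a b * B a b * C a b := by
  have h : ((Real.sqrt 2 : ℝ) : ℂ)⁻¹ * ((Real.sqrt 2 : ℝ) : ℂ)⁻¹ = 1 / 2 := by
    rw [← mul_inv, ← Complex.ofReal_mul, Real.mul_self_sqrt (by norm_num)]
    norm_num
  simp only [Matrix.trace, Matrix.diag, Matrix.mul_apply, Matrix.kroneckerMap_apply,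
    Matrix.vecMulVec_apply, Pi.star_apply, Fintype.sum_prod_type, Fin.sum_univ_two, ghz_apply]
  simp
  linear_combination (A 0 0 * B 0 0 * C 0 0 + A 0 1 * B 0 1 * C 0 1 + A 1 0 * B 1 0 * C 1 0
    + A 1 1 * B 1 1 * C 1 1) * h

lemma trace_pauli_succ (i : Fin 3) : (pauli i.succ).trace = 0 := by
  fin_cases i <;> simp [pauli, Matrix.trace_fin_two]

lemma trace_kronecker_mul_wernerGHZ (l : ℝ) {A : Matrix (Fin 2) (Fin 2) ℂ} (hA : A.trace = 0)
    (B C : Matrix (Fin 2) (Fin 2) ℂ) :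
    ((A ⊗ₖ (B ⊗ₖ C)) * wernerGHZ l).trace =
      l / 2 * ∑ a, ∑ b, A a b * B a b * C a b := by
  rw [wernerGHZ, mul_add, Matrix.trace_add, Matrix.mul_smul, Matrix.mul_smul, Matrix.trace_smul,
    Matrix.trace_smul, Matrix.mul_one, Matrix.trace_kronecker, hA,
    trace_kronecker_mul_vecMulVec_ghz, smul_eq_mul, smul_eq_mul]
  ring

lemma corrMatWernerGHZ_apply (l : ℝ) (i : Fin 3) (j k : Fin 4) :
    corrMatWernerGHZ l i (j, k) = l / (4 * Real.sqrt 2) *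
      (∑ a, ∑ b, pauli i.succ a b * pauli j a b * pauli k a b).re := by
  rw [corrMatWernerGHZ, Matrix.of_apply, trace_kronecker_mul_wernerGHZ l (trace_pauli_succ i),
    ← Complex.ofReal_ofNat, ← Complex.ofReal_div, Complex.re_ofReal_mul]
  ring

lemma corrMatWernerGHZ_mul_transpose (l : ℝ) :
    corrMatWernerGHZ l * (corrMatWernerGHZ l)ᵀ = (l ^ 2 / 4) • (1 : Matrix (Fin 3) (Fin 3) ℝ) := by
  have h : (l / (4 * Real.sqrt 2)) ^ 2 = l ^ 2 / 32 := by
    rw [div_pow, mul_pow, Real.sq_sqrt (by norm_num)]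
    norm_num
  ext i i'
  rw [Matrix.mul_apply, Fintype.sum_prod_type]
  simp only [Matrix.transpose_apply, corrMatWernerGHZ_apply]
  generalize l / (4 * Real.sqrt 2) = c at h
  fin_cases i <;> fin_cases i' <;> simp [Fin.sum_univ_succ, pauli] <;> linear_combination 8 * h

lemma trace_sub_mul_mul_transpose {m n : Type*} [Fintype m] [DecidableEq m] [Fintype n]
    {M : Matrix m n ℝ} {c : ℝ} (hM : M * Mᵀ = c • (1 : Matrix m m ℝ)) {P : Matrix m m ℝ}
    (hPt : Pᵀ = P) (hP : P * P = P) :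
    ((M - P * M) * (M - P * M)ᵀ).trace = c * (Fintype.card m - P.rank) := by
  have hfac : M - P * M = (1 - P) * M := by rw [Matrix.sub_mul, Matrix.one_mul]
  have htr : P.trace = P.rank := by
    have hproj : LinearMap.IsProj P.mulVecLin.range P.mulVecLin :=
      LinearMap.IsIdempotentElem.isProj_range _ <| by
        rw [IsIdempotentElem, Module.End.mul_eq_comp, ← Matrix.mulVecLin_mul, hP]
    rw [Matrix.rank, ← hproj.trace, ← Matrix.toLin'_apply', Matrix.trace_toLin'_eq]
  have hidem : (1 - P) * (1 - P) = 1 - P := IsIdempotentElem.one_sub hP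
  rw [hfac, Matrix.transpose_mul, Matrix.mul_assoc, ← Matrix.mul_assoc M, hM, Matrix.smul_mul,
    Matrix.one_mul, Matrix.mul_smul, Matrix.trace_smul, Matrix.transpose_sub, hPt,
    Matrix.transpose_one, hidem, Matrix.trace_sub, Matrix.trace_one, htr, smul_eq_mul]

/-- For the Werner-GHZ state, `M Mᵀ = (λ²/4) I₃`, and consequently the minimum of
`‖M - P M‖₂²` over rank-1 orthogonal projections `P` equals `λ²/2`. -/
theorem wernerGHZ_correlation (l : ℝ) (hl0 : 0 ≤ l) (hl1 : l ≤ 1) :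
    corrMatWernerGHZ l * (corrMatWernerGHZ l)ᵀ =
        (l ^ 2 / 4) • (1 : Matrix (Fin 3) (Fin 3) ℝ) ∧
      IsLeast {x : ℝ | ∃ P : Matrix (Fin 3) (Fin 3) ℝ, Pᵀ = P ∧ P * P = P ∧ P.rank = 1 ∧
          x = ((corrMatWernerGHZ l - P * corrMatWernerGHZ l) *
                (corrMatWernerGHZ l - P * corrMatWernerGHZ l)ᵀ).trace}
        (l ^ 2 / 2) := by
  have hM := corrMatWernerGHZ_mul_transpose l
  have key : ∀ P : Matrix (Fin 3) (Fin 3) ℝ, Pᵀ = P → P * P = P → P.rank = 1 →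
      ((corrMatWernerGHZ l - P * corrMatWernerGHZ l) *
        (corrMatWernerGHZ l - P * corrMatWernerGHZ l)ᵀ).trace = l ^ 2 / 2 := by
    intro P hPt hP hr
    rw [trace_sub_mul_mul_transpose hM hPt hP, hr, Fintype.card_fin]
    push_cast
    ring
  refine ⟨hM, ?_, ?_⟩
  · have hPt : (Matrix.diagonal (Pi.single 0 1) : Matrix (Fin 3) (Fin 3) ℝ)ᵀ =
        Matrix.diagonal (Pi.single 0 1) := Matrix.diagonal_transpose _
    have hP : (Matrix.diagonal (Pi.single 0 1) : Matrix (Fin 3) (Fin 3) ℝ) *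
        Matrix.diagonal (Pi.single 0 1) = Matrix.diagonal (Pi.single 0 1) := by
      rw [Matrix.diagonal_mul_diagonal]
      congr 1
      ext i
      simp [Pi.single_apply]
    have hr : (Matrix.diagonal (Pi.single 0 1) : Matrix (Fin 3) (Fin 3) ℝ).rank = 1 := by
      rw [Matrix.rank_diagonal, Fintype.card_eq_one_iff]
      exact ⟨⟨0, by simp⟩, fun ⟨i, hi⟩ => by simpa [Pi.single_apply] using hi⟩
    exact ⟨_, hPt, hP, hr, (key _ hPt hP hr).symm⟩
  · rintro x ⟨P, hPt, hP, hr, rfl⟩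
    exact (key P hPt hP hr).ge
end

section
/- Let n ≥ 1 and let ρ be a complex positive-semidefinite matrix of size 2n×2n (indexed by pairs in Fin 2 × Fin n, viewed as a state on ℂ²⊗ℂⁿ) with trace 1. Say ρ is classical-quantum if there exist an orthonormal basis {e₀, e₁} of ℂ² and positive-semidefinite n×n matrices ρ₀, ρ₁ such that ρ = (e₀e₀ᴴ) ⊗ ρ₀ + (e₁e₁ᴴ) ⊗ ρ₁ (Kronecker products). Then ρ is classical-quantum if and only if there exists a unit vector u ∈ ℝ³ such that for every complex n×n matrix O and every i ∈ {1,2,3}, Tr[(σᵢ ⊗ O)·ρ] = uᵢ · Σ_{j=1}^{3} uⱼ · Tr[(σⱼ ⊗ O)·ρ]; that is, the Pauli-coefficient vector (Tr[(σ₁⊗O)ρ], Tr[(σ₂⊗O)ρ], Tr[(σ₃⊗O)ρ]) is fixed by the rank-1 orthogonal projection u·uᵀ for every O. -/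
open Matrix Complex
open scoped Kronecker ComplexOrder

/-- The three Pauli matrices `σ₁, σ₂, σ₃`. -/
noncomputable def pauli3 : Fin 3 → Matrix (Fin 2) (Fin 2) ℂ
  | 0 => !![0, 1; 1, 0]
  | 1 => !![0, -I; I, 0]
  | 2 => !![1, 0; 0, -1]

/-- Every unit vector of `ℝ³` is the Bloch vector of a unit vector of `ℂ²`. -/
theorem exists_spinor_of_unit_vector (x y z : ℝ) (h : x ^ 2 + y ^ 2 + z ^ 2 = 1) :
    ∃ a b : ℂ, a * star a + b * star b = 1 ∧ (x : ℂ) = star a * b + a * star b ∧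
      (y : ℂ) = I * (a * star b - star a * b) ∧ (z : ℂ) = a * star a - b * star b := by
  by_cases hz : 1 + z = 0
  · have hz' : z = -1 := by linarith
    subst hz'
    have hx : x = 0 := by nlinarith [sq_nonneg x, sq_nonneg y]
    have hy : y = 0 := by nlinarith [sq_nonneg x, sq_nonneg y]
    exact ⟨0, 1, by simp, by simp [hx], by simp [hy], by simp⟩
  · have hpos : 0 < 1 + z := lt_of_le_of_ne (by nlinarith [sq_nonneg x, sq_nonneg y]) (Ne.symm hz)
    obtain ⟨s, hs0, hs⟩ : ∃ s : ℝ, s ≠ 0 ∧ s ^ 2 = (1 + z) / 2 :=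
      ⟨√((1 + z) / 2), (Real.sqrt_pos.2 (by linarith)).ne', Real.sq_sqrt (by linarith)⟩
    have hsC : (s : ℂ) ≠ 0 := by exact_mod_cast hs0
    have hs' : (s : ℂ) ^ 2 = (1 + z) / 2 := by exact_mod_cast congrArg ((↑) : ℝ → ℂ) hs
    have h' : (x : ℂ) ^ 2 + y ^ 2 + z ^ 2 = 1 := by exact_mod_cast congrArg ((↑) : ℝ → ℂ) h
    have hb : ((x + y * I) / (2 * s) : ℂ) * ((x - y * I) / (2 * s)) = (1 - z) / 2 := by
      have hI := I_sq
      field_simp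
      linear_combination h' - 2 * (1 - z) * hs' - y ^ 2 * hI
    have hstar : star ((x + y * I) / (2 * s) : ℂ) = (x - y * I) / (2 * s) := by
      simp [sub_eq_add_neg]
    have hstar' : star (s : ℂ) = s := by simp
    refine ⟨s, (x + y * I) / (2 * s), ?_, ?_, ?_, ?_⟩ <;> rw [hstar, hstar']
    · linear_combination hs' + hb
    · field_simp
      ring
    · have hI := I_sq
      field_simp
      linear_combination (2 * y : ℂ) * hI
    · linear_combination hb - hs'

/-- Traces against `A ⊗ O` in terms of the four blocks of `ρ`. -/
theorem trace_kronecker_mul_fin_two {n : ℕ} (A : Matrix (Fin 2) (Fin 2) ℂ)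
    (O : Matrix (Fin n) (Fin n) ℂ) (ρ : Matrix (Fin 2 × Fin n) (Fin 2 × Fin n) ℂ) :
    ((A ⊗ₖ O) * ρ).trace =
      ∑ a, ∑ b, A a b * (O * Matrix.of fun k l => ρ (b, k) (a, l)).trace := by
  simp only [Matrix.trace, Matrix.diag, Matrix.mul_apply, Fintype.sum_prod_type,
    kroneckerMap_apply, Matrix.of_apply, Finset.mul_sum]
  refine Finset.sum_congr rfl fun a _ => ?_
  rw [Finset.sum_comm]
  simp only [mul_assoc]

/-- The compression `(eᴴ ⊗ 1) ρ (e ⊗ 1)` of a positive-semidefinite matrix is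
positive-semidefinite. -/
theorem posSemidef_compression {m n : Type*} [Fintype m] [Fintype n] [DecidableEq n]
    {ρ : Matrix (m × n) (m × n) ℂ} (hρ : ρ.PosSemidef) (e : m → ℂ) :
    (Matrix.of fun k l => ∑ a, ∑ b, star (e a) * e b * ρ (a, k) (b, l)).PosSemidef := by
  convert hρ.conjTranspose_mul_mul_same
    (Matrix.of fun (p : m × n) (l : n) => if p.2 = l then e p.1 else 0) using 1
  ext k l
  simp only [Matrix.mul_apply, Matrix.conjTranspose_apply, Matrix.of_apply,
    Fintype.sum_prod_type, apply_ite star, star_zero, ite_mul, zero_mul, mul_ite, mul_zero,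
    Finset.sum_ite_eq', Finset.mem_univ, if_true, Finset.sum_mul]
  rw [Finset.sum_comm]
  refine Finset.sum_congr rfl fun b _ => Finset.sum_congr rfl fun a _ => ?_
  ring

/-- Completeness relation for an orthonormal basis of `ℂ²`. -/
theorem vecMulVec_add_vecMulVec_eq_one {e₀ e₁ : Fin 2 → ℂ} (h₀ : star e₀ ⬝ᵥ e₀ = 1)
    (h₁ : star e₁ ⬝ᵥ e₁ = 1) (h : star e₀ ⬝ᵥ e₁ = 0) :
    vecMulVec e₀ (star e₀) + vecMulVec e₁ (star e₁) = 1 := by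
  have h' : star e₁ ⬝ᵥ e₀ = 0 := by
    rw [Matrix.star_dotProduct, h, star_zero]
  have hU : (Matrix.of ![star e₀, star e₁]) * (Matrix.of ![e₀, e₁])ᵀ = 1 := by
    ext i j
    rw [Matrix.mul_apply]
    fin_cases i <;> fin_cases j
    · simpa [dotProduct] using h₀
    · simpa [dotProduct] using h
    · simpa [dotProduct] using h'
    · simpa [dotProduct] using h₁
  rw [← mul_eq_one_comm.1 hU]
  ext i j
  simp [Matrix.mul_apply, vecMulVec_apply]

theorem trace_pauli3 (i : Fin 3) : (pauli3 i).trace = 0 := by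
  fin_cases i <;> simp [pauli3, Matrix.trace_fin_two]

/-- The Bloch vector of a unit vector of `ℂ²` is a real unit vector. -/
theorem exists_unit_vector_of_spinor {e : Fin 2 → ℂ} (h : star e ⬝ᵥ e = 1) :
    ∃ u : Fin 3 → ℝ, ∑ i, u i ^ 2 = 1 ∧
      ∀ i, (pauli3 i * vecMulVec e (star e)).trace = u i := by
  have hn : (e 0).re ^ 2 + (e 0).im ^ 2 + (e 1).re ^ 2 + (e 1).im ^ 2 = 1 := by
    have := congrArg Complex.re h
    simp [dotProduct, Fin.sum_univ_two] at this
    linarith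
  refine ⟨![2 * ((e 0).re * (e 1).re + (e 0).im * (e 1).im),
    2 * ((e 0).re * (e 1).im - (e 0).im * (e 1).re),
    (e 0).re ^ 2 + (e 0).im ^ 2 - (e 1).re ^ 2 - (e 1).im ^ 2], ?_, ?_⟩
  · simp [Fin.sum_univ_three]
    linear_combination ((e 0).re ^ 2 + (e 0).im ^ 2 + (e 1).re ^ 2 + (e 1).im ^ 2 + 1) * hn
  · intro i
    simp only [Matrix.trace_fin_two, Matrix.mul_apply, Fin.sum_univ_two, vecMulVec_apply]
    fin_cases i <;>
      simp [pauli3, Complex.ext_iff, -ofReal_pow, -ofReal_mul, -ofReal_add, -ofReal_sub, pow_two] <;>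
      (try constructor) <;> ring

/-- A `2 × 2` matrix whose Pauli vector is `s` times the Bloch vector of the unit vector
`(a, b)` is diagonal in the basis `(a, b)`, `(-b̄, ā)`. -/
theorem eq_sum_vecMulVec_of_bloch {a b s : ℂ} {x : Fin 2 → Fin 2 → ℂ}
    (h : a * star a + b * star b = 1) (h₁ : x 0 1 = a * star b * s)
    (h₂ : x 1 0 = star a * b * s) (h₃ : x 0 0 - x 1 1 = (a * star a - b * star b) * s)
    (i j : Fin 2) :
    x i j =
      vecMulVec ![a, b] (star ![a, b]) i j *
        (∑ c, ∑ d, star (![a, b] c) * ![a, b] d * x c d) +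
      vecMulVec ![-star b, star a] (star ![-star b, star a]) i j *
        (∑ c, ∑ d, star (![-star b, star a] c) * ![-star b, star a] d * x c d) := by
  have h₀ : x 0 0 = x 1 1 + (a * star a - b * star b) * s := by linear_combination h₃
  have t₀ : ∑ c, ∑ d, star (![a, b] c) * ![a, b] d * x c d = x 1 1 + a * star a * s := by
    simp only [Fin.sum_univ_two, Matrix.cons_val_zero, Matrix.cons_val_one, h₀, h₁, h₂]
    linear_combination (x 1 1 + a * star a * s) * h
  have t₁ : ∑ c, ∑ d, star (![-star b, star a] c) * ![-star b, star a] d * x c d =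
      x 1 1 - b * star b * s := by
    simp only [Fin.sum_univ_two, Matrix.cons_val_zero, Matrix.cons_val_one, h₀, h₁, h₂,
      star_neg, star_star]
    linear_combination (x 1 1 - b * star b * s) * h
  rw [t₀, t₁]
  fin_cases i <;> fin_cases j <;>
    simp only [vecMulVec_apply, Pi.star_apply, Fin.zero_eta, Fin.mk_one, Fin.isValue,
      Matrix.cons_val_zero, Matrix.cons_val_one, h₀, h₁, h₂, star_neg, star_star]
  · linear_combination (-x 1 1 - (a * star a - b * star b) * s) * h
  · linear_combination (-a * star b * s) * h
  · linear_combination (-star a * b * s) * h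
  · linear_combination (-x 1 1) * h

/-- A state `ρ` on `ℂ² ⊗ ℂⁿ` is classical-quantum (i.e. of the form
`e₀e₀ᴴ ⊗ ρ₀ + e₁e₁ᴴ ⊗ ρ₁` for an orthonormal basis `{e₀, e₁}` of `ℂ²` and
positive-semidefinite `ρ₀, ρ₁`) if and only if there is a unit vector `u ∈ ℝ³`
such that for every `n × n` matrix `O` the Pauli-coefficient vector
`(Tr[(σᵢ ⊗ O) ρ])ᵢ` is fixed by the rank-1 orthogonal projection `u uᵀ`. -/
theorem classicalQuantum_iff_pauli_vector_fixed {n : ℕ} (hn : 1 ≤ n)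
    (ρ : Matrix (Fin 2 × Fin n) (Fin 2 × Fin n) ℂ)
    (hρ : ρ.PosSemidef) (htr : ρ.trace = 1) :
    (∃ (e₀ e₁ : Fin 2 → ℂ) (ρ₀ ρ₁ : Matrix (Fin n) (Fin n) ℂ),
        star e₀ ⬝ᵥ e₀ = 1 ∧ star e₁ ⬝ᵥ e₁ = 1 ∧ star e₀ ⬝ᵥ e₁ = 0 ∧
        ρ₀.PosSemidef ∧ ρ₁.PosSemidef ∧
        ρ = Matrix.vecMulVec e₀ (star e₀) ⊗ₖ ρ₀ +
            Matrix.vecMulVec e₁ (star e₁) ⊗ₖ ρ₁) ↔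
      ∃ u : Fin 3 → ℝ, (∑ i, u i ^ 2 = 1) ∧
        ∀ (O : Matrix (Fin n) (Fin n) ℂ) (i : Fin 3),
          ((pauli3 i ⊗ₖ O) * ρ).trace =
            (u i : ℂ) * ∑ j, (u j : ℂ) * ((pauli3 j ⊗ₖ O) * ρ).trace := by
  constructor
  · rintro ⟨e₀, e₁, ρ₀, ρ₁, h₀, h₁, h, -, -, rfl⟩
    obtain ⟨u, hu, hσ⟩ := exists_unit_vector_of_spinor h₀
    have hσ' (i : Fin 3) : (pauli3 i * vecMulVec e₁ (star e₁)).trace = -u i := by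
      rw [eq_sub_of_add_eq' (vecMulVec_add_vecMulVec_eq_one h₀ h₁ h), mul_sub, trace_sub, mul_one,
        trace_pauli3, hσ, zero_sub]
    have huC : ∑ i, (u i : ℂ) ^ 2 = 1 := by exact_mod_cast congrArg ((↑) : ℝ → ℂ) hu
    refine ⟨u, hu, fun O i => ?_⟩
    simp only [mul_add, trace_add, ← mul_kronecker_mul, trace_kronecker, hσ, hσ']
    rw [Fin.sum_univ_three] at huC ⊢
    linear_combination (-(u i : ℂ) * ((O * ρ₀).trace - (O * ρ₁).trace)) * huC
  · rintro ⟨u, hu, hfix⟩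
    rw [Fin.sum_univ_three] at hu
    obtain ⟨a, b, hab, hx, hy, hz⟩ := exists_spinor_of_unit_vector _ _ _ hu
    refine ⟨![a, b], ![-star b, star a], _, _, ?_, ?_, ?_, posSemidef_compression hρ ![a, b],
      posSemidef_compression hρ ![-star b, star a], ?_⟩
    · simp only [dotProduct, Fin.sum_univ_two, Pi.star_apply, Matrix.cons_val_zero,
        Matrix.cons_val_one]
      linear_combination hab
    · simp only [dotProduct, Fin.sum_univ_two, Pi.star_apply, Matrix.cons_val_zero,
        Matrix.cons_val_one, star_neg, star_star]
      linear_combination hab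
    · simp only [dotProduct, Fin.sum_univ_two, Pi.star_apply, Matrix.cons_val_zero,
        Matrix.cons_val_one]
      ring
    · ext ⟨i, k⟩ ⟨j, l⟩
      have hf := hfix (Matrix.single l k 1)
      simp only [trace_kronecker_mul_fin_two, Matrix.trace_single_mul, Matrix.of_apply,
        one_mul, Fin.sum_univ_two, smul_eq_mul] at hf
      obtain ⟨s, hs⟩ : ∃ s, s = ∑ m, (u m : ℂ) *
          (pauli3 m 0 0 * ρ (0, k) (0, l) + pauli3 m 0 1 * ρ (1, k) (0, l) +
            (pauli3 m 1 0 * ρ (0, k) (1, l) + pauli3 m 1 1 * ρ (1, k) (1, l))) := ⟨_, rfl⟩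
      simp only [← hs] at hf
      have f₁ := hf 0
      have f₂ := hf 1
      have f₃ := hf 2
      simp [pauli3] at f₁ f₂ f₃
      simp only [Matrix.add_apply, kroneckerMap_apply, Matrix.of_apply]
      rw [hx] at f₁
      rw [hy] at f₂
      rw [hz] at f₃
      have hI := I_sq
      refine eq_sum_vecMulVec_of_bloch (x := fun i j => ρ (i, k) (j, l)) (s := s) hab ?_ ?_ ?_ i j
      · linear_combination (1 / 2 : ℂ) * f₁ - (I / 2) * f₂ +
          ((ρ (0, k) (1, l) - ρ (1, k) (0, l)) / 2 - (a * star b - star a * b) * s / 2) * hI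
      · linear_combination (1 / 2 : ℂ) * f₁ + (I / 2) * f₂ -
          ((ρ (0, k) (1, l) - ρ (1, k) (0, l)) / 2 - (a * star b - star a * b) * s / 2) * hI
      · linear_combination f₃
end
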